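/- Let φ be a Sturmian coloring of a d-regular tree T with S_0 = [a] and B_0 = [b]. The labels A_{n+1}, B_{n+1} of the two distinct classes of (n+1)-balls extending the special n-ball S_n can be chosen for all n ≥ 0 so that A_{n+1} is always adjacent to A_n and B_{n+1} is always adjacent to B_n. Moreover, the number of balls of class A_n (resp. of class B_n) adjacent to a ball of class A_{n+1} or of class B_{n+1} depends only on the classes involved, and the labeling is uniquely determined by requiring in addition that A_{n+1} contains more adjacent balls of class A_n than B_{n+1} does. -/

import Mathlib

open scoped Classical

noncomputable section

namespace Sturm

variable {V α : Type}

/-- `G` is a `d`-regular tree. -/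
structure IsRegularTree (G : SimpleGraph V) (d : ℕ) : Prop where
  isTree : G.IsTree
  regular : ∀ v : V, (G.neighborSet v).ncard = d

/-- Color-preserving isomorphism of the `n`-balls centered at `x` and `y`,
sending center to center. -/
def BallEquiv (G : SimpleGraph V) (φ : V → α) (n : ℕ) (x y : V) : Prop :=
  ∃ f : {z : V // G.dist x z ≤ n} ≃ {z : V // G.dist y z ≤ n},
    (∀ u v : {z : V // G.dist x z ≤ n}, G.Adj u.1 v.1 ↔ G.Adj (f u).1 (f v).1) ∧
    (∀ u : {z : V // G.dist x z ≤ n}, φ (f u).1 = φ u.1) ∧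
    ((f ⟨x, by rw [SimpleGraph.dist_self]; exact Nat.zero_le n⟩).1 = y)

/-- The class of the `n`-ball at `x`, viewed as the set of all centers of equivalent balls. -/
def ballClass (G : SimpleGraph V) (φ : V → α) (n : ℕ) (x : V) : Set V :=
  {y | BallEquiv G φ n x y}

/-- The set `B_n(φ)` of classes of `n`-balls occurring in `(T, φ)`. -/
def ballClasses (G : SimpleGraph V) (φ : V → α) (n : ℕ) : Set (Set V) :=
  {C | ∃ x, C = ballClass G φ n x}

/-- A coloring is Sturmian if its factor complexity is `n + 2`. -/
def IsSturmian (G : SimpleGraph V) (φ : V → α) : Prop :=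
  ∀ n, (ballClasses G φ n).ncard = n + 2

/-- `x` is the center of a special `n`-ball. -/
def IsSpecialVert (G : SimpleGraph V) (φ : V → α) (n : ℕ) (x : V) : Prop :=
  ∃ y, BallEquiv G φ n x y ∧ ¬ BallEquiv G φ (n + 1) x y

/-- `S` is a special class of `n`-balls: the restriction of two distinct classes of
`(n+1)`-balls. -/
def IsSpecialClass (G : SimpleGraph V) (φ : V → α) (n : ℕ) (S : Set V) : Prop :=
  ∃ x, S = ballClass G φ n x ∧ IsSpecialVert G φ n x

/-- The class `D` is always adjacent to the class `E`. -/
def AlwaysAdjTo (G : SimpleGraph V) (D E : Set V) : Prop :=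
  ∀ x ∈ D, ∃ y, G.Adj x y ∧ y ∈ E

/-- The classes `D` and `E` are (always) adjacent. -/
def AlwaysAdj (G : SimpleGraph V) (D E : Set V) : Prop :=
  AlwaysAdjTo G D E ∧ AlwaysAdjTo G E D

/-- The classes `D` and `E` can be adjacent. -/
def CanAdj (G : SimpleGraph V) (D E : Set V) : Prop :=
  ∃ x ∈ D, ∃ y ∈ E, G.Adj x y

/-- The number of neighbors of `x` lying in (i.e. being centers of balls of class) `E`. -/
def nbrCount (G : SimpleGraph V) (x : V) (E : Set V) : ℕ :=
  (G.neighborSet x ∩ E).ncard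

/-- The data of the labels `S_n, C_n, A_n, B_n` for a Sturmian coloring, normalized as in
the paper: `S_0 = A_0 = [a]`, `B_0 = [b]`, `A_{n+1}` (resp. `B_{n+1}`) is always adjacent
to `A_n` (resp. `B_n`), and `A_{n+1}, B_{n+1}` are the two distinct extensions of `S_n`. -/
structure Labeling (G : SimpleGraph V) (φ : V → α) (a b : α) where
  S : ℕ → Set V
  C : ℕ → Set V
  A : ℕ → Set V
  B : ℕ → Set V
  S_special : ∀ n, IsSpecialClass G φ n (S n)
  C_central : ∀ n, ∃ x, IsSpecialVert G φ (n + 1) x ∧ S (n + 1) = ballClass G φ (n + 1) x ∧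
      C n = ballClass G φ n x
  A0_eq_S0 : A 0 = S 0
  A0_col : ∃ x, φ x = a ∧ A 0 = ballClass G φ 0 x
  B0_col : ∃ x, φ x = b ∧ B 0 = ballClass G φ 0 x
  A_ext : ∀ n, ∃ x, IsSpecialVert G φ n x ∧ S n = ballClass G φ n x ∧
      A (n + 1) = ballClass G φ (n + 1) x
  B_ext : ∀ n, ∃ x, IsSpecialVert G φ n x ∧ S n = ballClass G φ n x ∧
      B (n + 1) = ballClass G φ (n + 1) x
  AB_ne : ∀ n, A (n + 1) ≠ B (n + 1)
  A_adj : ∀ n, AlwaysAdjTo G (A (n + 1)) (A n)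
  B_adj : ∀ n, AlwaysAdjTo G (B (n + 1)) (B n)

/-- A cycle (of length `≥ 3`, with pairwise distinct vertices) in the graph `G_n` of
classes of `n`-balls, where classes are joined when they can be adjacent. -/
def IsCycleIn (G : SimpleGraph V) (φ : V → α) (n k : ℕ) (c : ℕ → Set V) : Prop :=
  3 ≤ k ∧ (∀ i < k, c i ∈ ballClasses G φ n) ∧
    (∀ i < k, CanAdj G (c i) (c ((i + 1) % k))) ∧
    (∀ i < k, ∀ j < k, c i = c j → i = j)

/-- The graph `G_n` contains a cycle. -/
def HasCycle (G : SimpleGraph V) (φ : V → α) (n : ℕ) : Prop :=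
  ∃ k c, IsCycleIn G φ n k c

/-! ## Edge-indexed colored graphs -/

/-- An edge-indexed graph, with vertices colored by `α` and labeled by classes
(sets of vertices of the underlying tree `V`). Index `0` means "no edge". -/
structure EIG (V α : Type) where
  Vert : Type
  idx : Vert → Vert → ℕ
  col : Vert → α
  lab : Vert → Set V

/-- Isomorphism of colored edge-indexed graphs. -/
structure EIGIso (X Y : EIG V α) where
  e : X.Vert ≃ Y.Vert
  idx_eq : ∀ u v, Y.idx (e u) (e v) = X.idx u v
  col_eq : ∀ u, Y.col (e u) = X.col u

/-- The index `i_A(D, E)` (resp. `i_B`, `i`) at the level of classes: the number of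
neighbors, in class `E`, of a representative center of `D`; when `D` is the special
class `Sp`, the representative is taken with extension of class `Ext`. -/
def classIdx (G : SimpleGraph V) (Sp Ext : Set V) (D E : Set V) : ℕ :=
  if D = Sp then (if h : Ext.Nonempty then nbrCount G h.some E else 0)
  else (if h : D.Nonempty then nbrCount G h.some E else 0)

/-- The classes of `n`-balls joined to `Sp` by a path of edges of positive `J`-index. -/
def reachSet (G : SimpleGraph V) (φ : V → α) (n : ℕ) (Sp : Set V)
    (J : Set V → Set V → ℕ) : Set (Set V) :=
  {D | ∃ k, ∃ c : ℕ → Set V, c 0 = Sp ∧ c k = D ∧ (∀ i ≤ k, c i ∈ ballClasses G φ n) ∧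
    ∀ i < k, 0 < J (c i) (c (i + 1)) ∨ 0 < J (c (i + 1)) (c i)}

/-- Color of a class: the color of (the center of) any of its representatives. -/
def colOf [Nonempty V] (φ : V → α) (D : Set V) : α :=
  if h : D.Nonempty then φ h.some else φ (Classical.arbitrary V)

/-- The edge-indexed graph `G^A_n` (when `Ext = A_{n+1}`) resp. `G^B_n`. -/
def sideEIG [Nonempty V] (G : SimpleGraph V) (φ : V → α) (n : ℕ) (Sp Ext : Set V) :
    EIG V α where
  Vert := {D : Set V // D ∈ reachSet G φ n Sp (classIdx G Sp Ext)}
  idx := fun D E => classIdx G Sp Ext D.1 E.1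
  col := fun D => colOf φ D.1
  lab := fun D => D.1

variable {G : SimpleGraph V} {φ : V → α} {a b : α}

/-- The edge-indexed graph `G^A_n`. -/
def GAeig [Nonempty V] (L : Labeling G φ a b) (n : ℕ) : EIG V α :=
  sideEIG G φ n (L.S n) (L.A (n + 1))

/-- The edge-indexed graph `G^B_n`. -/
def GBeig [Nonempty V] (L : Labeling G φ a b) (n : ℕ) : EIG V α :=
  sideEIG G φ n (L.S n) (L.B (n + 1))

/-- Vertex set of `G^A_n`. -/
def VGAset (L : Labeling G φ a b) (n : ℕ) : Set (Set V) :=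
  reachSet G φ n (L.S n) (classIdx G (L.S n) (L.A (n + 1)))

/-- Vertex set of `G^B_n`. -/
def VGBset (L : Labeling G φ a b) (n : ℕ) : Set (Set V) :=
  reachSet G φ n (L.S n) (classIdx G (L.S n) (L.B (n + 1)))

/-- `G^A_n` or `G^B_n`, selected by a letter (`true = A`, `false = B`). -/
def GsideEIG [Nonempty V] (L : Labeling G φ a b) (n : ℕ) : Bool → EIG V α
  | true => GAeig L n
  | false => GBeig L n

/-- Vertex set of `G^A_n` or `G^B_n`, selected by a letter. -/
def VGside (L : Labeling G φ a b) (n : ℕ) : Bool → Set (Set V)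
  | true => VGAset L n
  | false => VGBset L n

/-- A single vertex with a loop of index `d` (the graph `G^A_{-1} = G^B_{-1} = F^._{-1}`). -/
def baseEIG (V : Type) (x : α) (d : ℕ) : EIG V α where
  Vert := PUnit
  idx := fun _ _ => d
  col := fun _ => x
  lab := fun _ => Set.univ

/-- `GAx L d (n+1) = G^A_n`, and `GAx L d 0 = G^A_{-1}`. -/
def GAx [Nonempty V] (L : Labeling G φ a b) (d : ℕ) : ℕ → EIG V α
  | 0 => baseEIG V a d
  | n + 1 => GAeig L n

/-- `GBx L d (n+1) = G^B_n`, and `GBx L d 0 = G^B_{-1}`. -/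
def GBx [Nonempty V] (L : Labeling G φ a b) (d : ℕ) : ℕ → EIG V α
  | 0 => baseEIG V b d
  | n + 1 => GBeig L n

/-- `Cx L (n+1) = C_n`, and `Cx L 0 = C_{-1}` (the class of the empty ball). -/
def Cx (L : Labeling G φ a b) : ℕ → Set V
  | 0 => Set.univ
  | n + 1 => L.C n

/-! ## Concatenations -/

/-- The `(i)`-concatenation of two edge-indexed graphs at the end vertices `v, v'`
(which are identified). -/
def concatI (X Y : EIG V α) (v : X.Vert) (v' : Y.Vert) (i : ℕ) : EIG V α where
  Vert := X.Vert ⊕ {w : Y.Vert // w ≠ v'}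
  idx := fun p q =>
    match p, q with
    | Sum.inl u, Sum.inl w =>
        if u = v ∧ w ≠ v then (if X.idx u w = 0 then 0 else i) else X.idx u w
    | Sum.inl u, Sum.inr w => if u = v then Y.idx v' w.1 - i else 0
    | Sum.inr w, Sum.inl u => if u = v then Y.idx w.1 v' else 0
    | Sum.inr w, Sum.inr w2 => Y.idx w.1 w2.1
  col := Sum.elim X.col (fun w => Y.col w.1)
  lab := Sum.elim X.lab (fun w => Y.lab w.1)

/-- The `(i,j)`-concatenation of two edge-indexed graphs at the end vertices `v, v'`
(which stay distinct, joined by a new edge of indices `i`, `j`). -/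
def concatIJ (X Y : EIG V α) (v : X.Vert) (v' : Y.Vert) (i j : ℕ) : EIG V α where
  Vert := X.Vert ⊕ Y.Vert
  idx := fun p q =>
    match p, q with
    | Sum.inl u, Sum.inl w => if u = v ∧ w = v then X.idx v v - i else X.idx u w
    | Sum.inl u, Sum.inr w => if u = v ∧ w = v' then i else 0
    | Sum.inr w, Sum.inl u => if w = v' ∧ u = v then j else 0
    | Sum.inr u, Sum.inr w => if u = v' ∧ w = v' then Y.idx v' v' - j else Y.idx u w
  col := Sum.elim X.col Y.col
  lab := Sum.elim X.lab Y.lab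

/-- `Z` is a concatenation ((i)- or (i,j)-) of `X` and `Y` at `(vX, vY)`. -/
def IsConcatOfAt (Z X Y : EIG V α) (vX : X.Vert) (vY : Y.Vert) : Prop :=
  (∃ i, 1 ≤ i ∧ Nonempty (EIGIso Z (concatI X Y vX vY i))) ∨
  (∃ i j, 1 ≤ i ∧ 1 ≤ j ∧ Nonempty (EIGIso Z (concatIJ X Y vX vY i j)))

/-! ## Paths, distance, degree in edge-indexed graphs -/

/-- Adjacency (by an edge of positive index, in one of the two orientations). -/
def EIGAdj (X : EIG V α) (u w : X.Vert) : Prop :=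
  u ≠ w ∧ (0 < X.idx u w ∨ 0 < X.idx w u)

/-- There is a path of length `L` from `u` to `w`. -/
def EIGReach (X : EIG V α) (u w : X.Vert) (L : ℕ) : Prop :=
  ∃ c : ℕ → X.Vert, c 0 = u ∧ c L = w ∧ ∀ i < L, EIGAdj X (c i) (c (i + 1))

/-- Graph distance in an edge-indexed graph. -/
def EIGDist (X : EIG V α) (u w : X.Vert) : ℕ :=
  sInf {L | EIGReach X u w L}

/-- `u` has degree one: there is exactly one vertex adjacent to it. -/
def EIGEndVert (X : EIG V α) (u : X.Vert) : Prop :=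
  ∃! w, EIGAdj X u w

/-! ## Coverings, direct limits, quotient graph, bounded type -/

/-- `p` exhibits the graph `H` as the universal cover of the edge-indexed graph `Y`:
above a vertex mapping to `u`, the number of neighbors above `w` is the index `idx u w`. -/
def IsEIGCover {W : Type} (H : SimpleGraph W) (Y : EIG V α) (p : W → Y.Vert) : Prop :=
  ∀ x : W, ∀ u : Y.Vert, (H.neighborSet x ∩ p ⁻¹' {u}).ncard = Y.idx (p x) u

/-- `Y` is the direct limit of the system `F` of colored edge-indexed graphs along the
inclusions `ι`. -/
def IsDirLimit (F : ℕ → EIG V α) (ι : ∀ k, (F k).Vert → (F (k + 1)).Vert)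
    (Y : EIG V α) : Prop :=
  ∃ j : ∀ k, (F k).Vert → Y.Vert,
    (∀ k v, j (k + 1) (ι k v) = j k v) ∧
    (∀ k, Function.Injective (j k)) ∧
    (∀ y, ∃ k v, j k v = y) ∧
    (∀ k v, Y.col (j k v) = (F k).col v) ∧
    (∀ y z : Y.Vert, ∃ N, ∀ k, N ≤ k → ∀ v w, j k v = y → j k w = z →
      Y.idx y z = (F k).idx v w)

/-- The coloring `φ` is of bounded type: every vertex has finite type set. -/
def BoundedType (G : SimpleGraph V) (φ : V → α) : Prop :=
  ∀ v : V, {m : ℕ | IsSpecialVert G φ m v}.Finite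

/-- Two vertices are related if some color-preserving automorphism maps one to the other. -/
def colorOrbitRel (G : SimpleGraph V) (φ : V → α) (x y : V) : Prop :=
  ∃ g : V ≃ V, (∀ u w, G.Adj u w ↔ G.Adj (g u) (g w)) ∧ (∀ u, φ (g u) = φ u) ∧ g x = y

/-- The quotient graph `X_φ = G\T` as a colored edge-indexed graph. -/
def quotEIG (G : SimpleGraph V) (φ : V → α) : EIG V α where
  Vert := Quot (colorOrbitRel G φ)
  idx := fun u w => (G.neighborSet u.out ∩ {z | Quot.mk (colorOrbitRel G φ) z = w}).ncard
  col := fun u => φ u.out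
  lab := fun u => {z | Quot.mk (colorOrbitRel G φ) z = u}

/-! ## The sequences `n_k`, `α_k`, `β_k` -/

/-- At level `n`, one of `A_n, B_n` is `S_n` or `C_n`. -/
def SpecTouch (L : Labeling G φ a b) (n : ℕ) : Prop :=
  L.A n = L.S n ∨ L.A n = L.C n ∨ L.B n = L.S n ∨ L.B n = L.C n

/-- `nk` is the increasing enumeration of the levels where `SpecTouch` holds. -/
def IsNkSeq (L : Labeling G φ a b) (nk : ℕ → ℕ) : Prop :=
  StrictMono nk ∧ ∀ n, (∃ k, nk k = n) ↔ SpecTouch L n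

/-- `αs` is the sequence `α_k`: `α_K = A`, and for `k ≠ K`, `α_k` is the side whose
graph `G^{α_k}_{n_k}` has more vertices. -/
def IsAlphaSeq (L : Labeling G φ a b) (nk : ℕ → ℕ) (K : ℕ∞) (αs : ℕ → Bool) : Prop :=
  ∀ k : ℕ, ((k : ℕ∞) = K → αs k = true) ∧
    ((k : ℕ∞) ≠ K → (αs k = true ↔
      (VGside L (nk k) false).ncard < (VGside L (nk k) true).ncard))

/-- The sequence `β_k(t)`: `β_{k-1}(t)` is the letter `ᾱ_k` if the class of the
`n_k`-ball at `t` is a vertex of `G^{ᾱ_k}_{n_k}`, and `α_k` otherwise. -/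
def betaOf (L : Labeling G φ a b) (nk : ℕ → ℕ) (αs : ℕ → Bool) (t : V) (k : ℕ) : Bool :=
  if ballClass G φ (nk (k + 1)) t ∈ VGside L (nk (k + 1)) (!(αs (k + 1))) then
    !(αs (k + 1))
  else αs (k + 1)

end Sturm

namespace Sturm
lemma eq_of_adj_of_dist {V : Type} {G : SimpleGraph V} (hT : G.IsTree) {r u v w : V}
    (hu : G.Adj u w) (hv : G.Adj v w) (hdu : G.dist r w = G.dist r u + 1)
    (hdv : G.dist r w = G.dist r v + 1) : u = v := by
  obtain ⟨p, -, hp⟩ := hT.connected.exists_path_of_dist r u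
  obtain ⟨q, -, hq⟩ := hT.connected.exists_path_of_dist r v
  have h1 : (p.concat hu).IsPath :=
    SimpleGraph.Walk.isPath_of_length_eq_dist _ (by rw [SimpleGraph.Walk.length_concat]; omega)
  have h2 : (q.concat hv).IsPath :=
    SimpleGraph.Walk.isPath_of_length_eq_dist _ (by rw [SimpleGraph.Walk.length_concat]; omega)
  have h := congrArg (fun c : G.Path r w => c.1.penultimate)
    ((hT.isAcyclic.subsingleton_path r w).elim ⟨_, h1⟩ ⟨_, h2⟩)
  simpa using h

lemma exists_adj_dist {V : Type} {G : SimpleGraph V} (hc : G.Connected) {r z : V}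
    (hz : G.dist r z ≠ 0) : ∃ p, G.Adj p z ∧ G.dist r z = G.dist r p + 1 := by
  obtain ⟨w, hw⟩ := hc.exists_walk_length_eq_dist z r
  cases w with
  | nil => simp at hz
  | @cons _ p _ h w =>
    refine ⟨p, h.symm, ?_⟩
    rw [SimpleGraph.Walk.length_cons, SimpleGraph.dist_comm] at hw
    have h1 := SimpleGraph.dist_le w
    have h2 := hc.dist_triangle (u := r) (v := p) (w := z)
    rw [SimpleGraph.dist_eq_one_iff_adj.2 h.symm] at h2
    rw [SimpleGraph.dist_comm] at h1
    omega

lemma dist_le_succ_of_adj {V : Type} {G : SimpleGraph V} (hc : G.Connected) (r : V) {u v : V}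
    (h : G.Adj u v) : G.dist r v ≤ G.dist r u + 1 := by
  have h2 := hc.dist_triangle (u := r) (v := u) (w := v)
  rwa [SimpleGraph.dist_eq_one_iff_adj.2 h] at h2

/-- Iterated color refinement: agreement of colors, together with a matching of the neighbors
that agree up to the previous level. -/
def Refine {V α : Type} (G : SimpleGraph V) (φ : V → α) : ℕ → V → V → Prop
  | 0, x, y => φ x = φ y
  | n + 1, x, y => φ x = φ y ∧
      ∃ σ : G.neighborSet x ≃ G.neighborSet y, ∀ z, Refine G φ n z.1 (σ z).1

section

variable {V α : Type} {G : SimpleGraph V} {φ : V → α}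

lemma Refine.color {n : ℕ} {x y : V} (h : Refine G φ n x y) : φ x = φ y := by
  cases n with
  | zero => exact h
  | succ n => exact h.1

lemma Refine.refl (n : ℕ) (x : V) : Refine G φ n x x := by
  induction n generalizing x with
  | zero => rfl
  | succ n ih => exact ⟨rfl, Equiv.refl _, fun z => ih z⟩

lemma Refine.symm {n : ℕ} {x y : V} (h : Refine G φ n x y) : Refine G φ n y x := by
  induction n generalizing x y with
  | zero => exact Eq.symm h
  | succ n ih =>
    obtain ⟨hc, σ, hσ⟩ := h
    exact ⟨hc.symm, σ.symm, fun z => ih (by simpa using hσ (σ.symm z))⟩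

lemma Refine.trans {n : ℕ} {x y z : V} (h : Refine G φ n x y) (h' : Refine G φ n y z) :
    Refine G φ n x z := by
  induction n generalizing x y z with
  | zero => exact Eq.trans h h'
  | succ n ih =>
    obtain ⟨hc, σ, hσ⟩ := h
    obtain ⟨hc', τ, hτ⟩ := h'
    exact ⟨hc.trans hc', σ.trans τ, fun w => ih (hσ w) (hτ (σ w))⟩

lemma Refine.of_succ {n : ℕ} {x y : V} (h : Refine G φ (n + 1) x y) : Refine G φ n x y := by
  induction n generalizing x y with
  | zero => exact h.1
  | succ n ih =>
    obtain ⟨hc, σ, hσ⟩ := h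
    exact ⟨hc, σ, fun z => ih (hσ z)⟩

lemma Refine.mono {m n : ℕ} (hmn : m ≤ n) {x y : V} (h : Refine G φ n x y) :
    Refine G φ m x y := by
  induction n, hmn using Nat.le_induction with
  | base => exact h
  | succ n _ ih => exact ih h.of_succ

/-- The matching of neighbors can be chosen to send a given neighbor to any equivalent one. -/
lemma Refine.exists_equiv {n : ℕ} {x y a a' : V} (h : Refine G φ (n + 1) x y)
    (ha : G.Adj x a) (ha' : G.Adj y a') (haa : Refine G φ n a a') :
    ∃ σ : G.neighborSet x ≃ G.neighborSet y,
      (∀ z, Refine G φ n z.1 (σ z).1) ∧ (σ ⟨a, ha⟩).1 = a' := by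
  obtain ⟨-, σ, hσ⟩ := h
  refine ⟨σ.trans (Equiv.swap (σ ⟨a, ha⟩) ⟨a', ha'⟩), fun z => ?_, by simp⟩
  simp only [Equiv.trans_apply]
  by_cases h1 : σ z = σ ⟨a, ha⟩
  · rw [h1, Equiv.swap_apply_left]
    have : z = ⟨a, ha⟩ := σ.injective h1
    rw [this]; exact haa
  · by_cases h2 : σ z = ⟨a', ha'⟩
    · rw [h2, Equiv.swap_apply_right]
      have hz := hσ z
      rw [h2] at hz
      exact hz.trans (haa.symm.trans (hσ ⟨a, ha⟩))
    · rw [Equiv.swap_apply_of_ne_of_ne h1 h2]; exact hσ z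

lemma finite_neighborSet {d : ℕ} (hd : 0 < d) (hT : IsRegularTree G d) (x : V) :
    (G.neighborSet x).Finite :=
  Set.finite_of_ncard_pos (by rw [hT.regular]; exact hd)

lemma image_neighborSet {d : ℕ} (hd : 0 < d) (hT : IsRegularTree G d) (f : V → V) {x y : V}
    (hadj : ∀ z, G.Adj x z → G.Adj y (f z)) (hinj : Set.InjOn f (G.neighborSet x)) :
    f '' G.neighborSet x = G.neighborSet y := by
  refine Set.eq_of_subset_of_ncard_le ?_ ?_ (finite_neighborSet hd hT y)
  · rintro _ ⟨z, hz, rfl⟩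
    exact hadj z hz
  · rw [hinj.ncard_image, hT.regular, hT.regular]

/-- A color-preserving embedding of a ball respects color refinement away from its boundary. -/
lemma refine_of_ball_map {d : ℕ} (hd : 0 < d) (hT : IsRegularTree G d) {n : ℕ} {x : V}
    (f : V → V) (hcol : ∀ z, G.dist x z ≤ n → φ (f z) = φ z)
    (hadj : ∀ u v, G.dist x u ≤ n → G.dist x v ≤ n → G.Adj u v → G.Adj (f u) (f v))
    (hinj : ∀ u v, G.dist x u ≤ n → G.dist x v ≤ n → f u = f v → u = v)
    {k : ℕ} {w : V} (hw : G.dist x w + k ≤ n) : Refine G φ k w (f w) := by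
  induction k generalizing w with
  | zero => exact (hcol w hw).symm
  | succ k ih =>
    have hb : ∀ z, G.Adj w z → G.dist x z + k ≤ n := fun z hz => by
      have := dist_le_succ_of_adj hT.isTree.connected x hz
      omega
    have hi : Set.InjOn f (G.neighborSet w) := fun u hu v hv huv =>
      hinj u v (by have := hb u hu; omega) (by have := hb v hv; omega) huv
    have him := image_neighborSet hd hT f (y := f w)
      (fun z hz => hadj w z (by omega) (by have := hb z hz; omega) hz) hi
    refine ⟨(hcol w (by omega)).symm,
      (Equiv.Set.imageOfInjOn f _ hi).trans (Equiv.setCongr him), fun z => ?_⟩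
    exact ih (hb z z.2)

lemma BallEquiv.refine {d : ℕ} (hd : 0 < d) (hT : IsRegularTree G d) {n : ℕ} {x y : V}
    (h : BallEquiv G φ n x y) : Refine G φ n x y := by
  obtain ⟨e, hadj, hcol, hxy⟩ := h
  let f : V → V := fun z => if hz : G.dist x z ≤ n then (e ⟨z, hz⟩).1 else z
  have hf : ∀ z (hz : G.dist x z ≤ n), f z = (e ⟨z, hz⟩).1 := fun z hz => dif_pos hz
  have hx : G.dist x x ≤ n := by simp
  have hfx : f x = y := (hf x hx).trans hxy
  rw [← hfx]
  refine refine_of_ball_map hd hT (n := n) (x := x) f (fun z hz => ?_) (fun u v hu hv huv => ?_)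
    (fun u v hu hv huv => ?_) (by simp)
  · rw [hf z hz]; exact hcol ⟨z, hz⟩
  · rw [hf u hu, hf v hv]; exact (hadj ⟨u, hu⟩ ⟨v, hv⟩).1 huv
  · rw [hf u hu, hf v hv] at huv
    exact congrArg Subtype.val (e.injective (Subtype.ext huv))

/-- A map on the ball of radius `k` around `x` onto that around `y`, compatible with colors,
whose values agree with their arguments up to refinement level `n - k`. -/
structure IsBallMap (G : SimpleGraph V) (φ : V → α) (n k : ℕ) (x y : V) (f : V → V) : Prop where
  dist : ∀ z, G.dist x z ≤ k → G.dist y (f z) = G.dist x z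
  adj : ∀ u v, G.dist x u ≤ k → G.dist x v ≤ k → G.Adj u v → G.Adj (f u) (f v)
  inj : ∀ u v, G.dist x u ≤ k → G.dist x v ≤ k → f u = f v → u = v
  refine : ∀ z, G.dist x z ≤ k → Refine G φ (n - k) z (f z)

lemma IsBallMap.exists_local {n k : ℕ} {x y : V} {f : V → V} (hT : G.IsTree)
    (hf : IsBallMap G φ n k x y f) (hk : k < n) {p : V} (hp : G.dist x p = k) :
    ∃ σ : V → V, (∀ z, G.Adj p z → G.Adj (f p) (σ z)) ∧
      (∀ z, G.Adj p z → Refine G φ (n - (k + 1)) z (σ z)) ∧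
      Set.InjOn σ (G.neighborSet p) ∧
      (∀ q, G.Adj p q → G.dist x q < k → σ q = f q) := by
  have hR : Refine G φ (n - (k + 1) + 1) p (f p) := by
    have := hf.refine p hp.le
    rwa [show n - k = n - (k + 1) + 1 by omega] at this
  have key : ∃ τ : G.neighborSet p ≃ G.neighborSet (f p),
      (∀ z, Refine G φ (n - (k + 1)) z.1 (τ z).1) ∧
      (∀ q (hq : G.Adj p q), G.dist x q < k → (τ ⟨q, hq⟩).1 = f q) := by
    by_cases h0 : k = 0
    · obtain ⟨-, τ, hτ⟩ := hR
      exact ⟨τ, hτ, fun q _ hq => by omega⟩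
    · obtain ⟨q, hqp, hq⟩ := exists_adj_dist hT.connected (r := x) (z := p) (by omega)
      obtain ⟨τ, hτ, hτq⟩ := hR.exists_equiv hqp.symm
        (hf.adj q p (by omega) (by omega) hqp).symm
        ((hf.refine q (by omega)).mono (by omega))
      refine ⟨τ, hτ, fun q' hq' hlt => ?_⟩
      have := hT.dist_eq_dist_add_one_of_adj x hq'
      have : q' = q := eq_of_adj_of_dist hT (r := x) hq'.symm hqp (by omega) hq
      subst this
      exact hτq
  obtain ⟨τ, hτ, hτq⟩ := key
  refine ⟨fun z => if hz : G.Adj p z then (τ ⟨z, hz⟩).1 else z, fun z hz => ?_, fun z hz => ?_,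
    fun u hu v hv huv => ?_, fun q hq hlt => ?_⟩
  · simp only [dif_pos hz]; exact (τ ⟨z, hz⟩).2
  · simp only [dif_pos hz]; exact hτ ⟨z, hz⟩
  · have hu' : G.Adj p u := hu
    have hv' : G.Adj p v := hv
    simp only [dif_pos hu', dif_pos hv'] at huv
    exact congrArg Subtype.val (τ.injective (Subtype.ext huv))
  · simp only [dif_pos hq]; exact hτq q hq hlt

lemma IsBallMap.exists_succ {n k : ℕ} {x y : V} {f : V → V} (hT : G.IsTree)
    (hf : IsBallMap G φ n k x y f) (hk : k < n) :
    ∃ f', IsBallMap G φ n (k + 1) x y f' := by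
  have hloc : ∀ p, ∃ σ : V → V, G.dist x p = k → (∀ z, G.Adj p z → G.Adj (f p) (σ z)) ∧
      (∀ z, G.Adj p z → Refine G φ (n - (k + 1)) z (σ z)) ∧
      Set.InjOn σ (G.neighborSet p) ∧
      (∀ q, G.Adj p q → G.dist x q < k → σ q = f q) := fun p => by
    by_cases hp : G.dist x p = k
    · obtain ⟨σ, hσ⟩ := hf.exists_local hT hk hp
      exact ⟨σ, fun _ => hσ⟩
    · exact ⟨id, fun h => absurd h hp⟩
  choose σ hσ using hloc
  have hpar : ∀ z, ∃ p, G.dist x z ≠ 0 → G.Adj p z ∧ G.dist x z = G.dist x p + 1 := fun z => by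
    by_cases hz : G.dist x z = 0
    · exact ⟨z, fun h => absurd hz h⟩
    · obtain ⟨p, hp⟩ := exists_adj_dist hT.connected hz
      exact ⟨p, fun _ => hp⟩
  choose par hpar using hpar
  let f' : V → V := fun z => if G.dist x z ≤ k then f z else σ (par z) z
  have hlow : ∀ z, G.dist x z ≤ k → f' z = f z := fun z hz => if_pos hz
  have hhigh : ∀ p z, G.Adj p z → G.dist x p = k → G.dist x z = k + 1 → f' z = σ p z := by
    intro p z hpz hp hz
    have h1 := hpar z (by omega)
    have : par z = p := eq_of_adj_of_dist hT (r := x) h1.1 hpz h1.2 (by omega)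
    simp only [f']
    rw [if_neg (by omega), this]
  have hadjtop : ∀ p z, G.Adj p z → G.dist x p = k → G.dist x z = k + 1 →
      G.Adj (f' p) (f' z) := by
    intro p z hpz hp hz
    rw [hhigh p z hpz hp hz, hlow p hp.le]
    exact (hσ p hp).1 z hpz
  have hdisttop : ∀ z, G.dist x z = k + 1 → G.dist y (f' z) = k + 1 := by
    intro z hz
    obtain ⟨p, hpz, hp⟩ := exists_adj_dist hT.connected (r := x) (z := z) (by omega)
    have hpk : G.dist x p = k := by omega
    have ha := hadjtop p z hpz hpk hz
    have hdp : G.dist y (f' p) = k := by rw [hlow p hpk.le, hf.dist p hpk.le, hpk]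
    rcases hT.dist_eq_dist_add_one_of_adj y ha with h | h
    · exfalso
      obtain ⟨q, hqp, hq⟩ := exists_adj_dist hT.connected (r := x) (z := p) (by omega)
      have hfq : f' q = σ p q := by
        rw [hlow q (by omega), (hσ p hpk).2.2.2 q hqp.symm (by omega)]
      have haq : G.Adj (f' q) (f' p) := by
        rw [hlow q (by omega), hlow p (by omega)]
        exact hf.adj q p (by omega) (by omega) hqp
      have hdq : G.dist y (f' q) = G.dist x q := by
        rw [hlow q (by omega), hf.dist q (by omega)]
      have heq : f' z = f' q := eq_of_adj_of_dist hT (r := y) ha.symm haq h (by omega)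
      rw [hhigh p z hpz hpk hz, hfq] at heq
      have := (hσ p hpk).2.2.1 hpz hqp.symm heq
      subst this
      omega
    · omega
  have hdist : ∀ z, G.dist x z ≤ k + 1 → G.dist y (f' z) = G.dist x z := by
    intro z hz
    by_cases h : G.dist x z ≤ k
    · rw [hlow z h, hf.dist z h]
    · rw [hdisttop z (by omega)]; omega
  refine ⟨f', hdist, fun u v hu hv huv => ?_, fun u v hu hv huv => ?_, fun z hz => ?_⟩
  · rcases hT.dist_eq_dist_add_one_of_adj x huv with h | h
    · by_cases h' : G.dist x u ≤ k
      · rw [hlow u h', hlow v (by omega)]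
        exact hf.adj u v h' (by omega) huv
      · exact (hadjtop v u huv.symm (by omega) (by omega)).symm
    · by_cases h' : G.dist x v ≤ k
      · rw [hlow v h', hlow u (by omega)]
        exact hf.adj u v (by omega) h' huv
      · exact hadjtop u v huv (by omega) (by omega)
  · have huv' : G.dist x u = G.dist x v := by rw [← hdist u hu, ← hdist v hv, huv]
    by_cases h : G.dist x u ≤ k
    · rw [hlow u h, hlow v (by omega)] at huv
      exact hf.inj u v h (by omega) huv
    · obtain ⟨p, hpu, hp⟩ := exists_adj_dist hT.connected (r := x) (z := u) (by omega)
      obtain ⟨q, hqv, hq⟩ := exists_adj_dist hT.connected (r := x) (z := v) (by omega)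
      have hau := hadjtop p u hpu (by omega) (by omega)
      have hav := hadjtop q v hqv (by omega) (by omega)
      rw [← huv] at hav
      have hpq : f' p = f' q := eq_of_adj_of_dist hT (r := y) hau hav
        (by rw [hdist u hu, hdist p (by omega), hp])
        (by rw [hdist u hu, hdist q (by omega), huv', hq])
      rw [hlow p (by omega), hlow q (by omega)] at hpq
      have := hf.inj p q (by omega) (by omega) hpq
      subst this
      rw [hhigh p u hpu (by omega) (by omega), hhigh p v hqv (by omega) (by omega)] at huv
      exact (hσ p (by omega)).2.2.1 hpu hqv huv
  · by_cases h : G.dist x z ≤ k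
    · rw [hlow z h]
      exact (hf.refine z h).mono (by omega)
    · obtain ⟨p, hpz, hp⟩ := exists_adj_dist hT.connected (r := x) (z := z) (by omega)
      rw [hhigh p z hpz (by omega) (by omega)]
      exact (hσ p (by omega)).2.1 z hpz

lemma Refine.exists_isBallMap (hT : G.IsTree) {n : ℕ} {x y : V} (h : Refine G φ n x y) {k : ℕ}
    (hk : k ≤ n) : ∃ f, IsBallMap G φ n k x y f := by
  induction k with
  | zero =>
    have h0 : ∀ z, G.dist x z ≤ 0 → z = x := fun z hz =>
      ((hT.connected.dist_eq_zero_iff).1 (Nat.le_zero.1 hz)).symm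
    refine ⟨fun _ => y, fun z hz => ?_, fun u v hu hv huv => ?_, fun u v hu hv _ => ?_,
      fun z hz => ?_⟩
    · rw [h0 z hz]; simp
    · rw [h0 u hu, h0 v hv] at huv
      exact absurd huv (G.loopless.irrefl x)
    · rw [h0 u hu, h0 v hv]
    · rw [h0 z hz]; exact h
  | succ k ih =>
    obtain ⟨f, hf⟩ := ih (by omega)
    exact hf.exists_succ hT hk

lemma Refine.ballEquiv {d : ℕ} (hd : 0 < d) (hT : IsRegularTree G d) {n : ℕ} {x y : V}
    (h : Refine G φ n x y) : BallEquiv G φ n x y := by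
  obtain ⟨f, hf⟩ := h.exists_isBallMap hT.isTree le_rfl
  have hfx : f x = y := by
    have := hf.dist x (by simp)
    rw [SimpleGraph.dist_self] at this
    exact ((hT.isTree.connected.dist_eq_zero_iff).1 this).symm
  have himage : ∀ w, G.dist x w < n → f '' G.neighborSet w = G.neighborSet (f w) := by
    intro w hw
    have hb : ∀ z, G.Adj w z → G.dist x z ≤ n := fun z hz => by
      have := dist_le_succ_of_adj hT.isTree.connected x hz
      omega
    exact image_neighborSet hd hT f (fun z hz => hf.adj w z hw.le (hb z hz) hz)
      (fun u hu v hv huv => hf.inj u v (hb u hu) (hb v hv) huv)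
  have hsurj : ∀ j ≤ n, ∀ z', G.dist y z' = j → ∃ z, G.dist x z ≤ j ∧ f z = z' := by
    intro j
    induction j with
    | zero =>
      intro _ z' hz'
      exact ⟨x, by simp, hfx.trans ((hT.isTree.connected.dist_eq_zero_iff).1 hz')⟩
    | succ j ih =>
      intro hj z' hz'
      obtain ⟨w', hw', hd'⟩ := exists_adj_dist hT.isTree.connected (r := y) (z := z') (by omega)
      obtain ⟨w, hw, rfl⟩ := ih (by omega) w' (by omega)
      have hz : z' ∈ G.neighborSet (f w) := hw'
      rw [← himage w (by omega)] at hz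
      obtain ⟨z, hz, rfl⟩ := hz
      have := dist_le_succ_of_adj hT.isTree.connected x hz
      exact ⟨z, by omega, rfl⟩
  have hadj' : ∀ u v, G.dist x u < n → G.dist x v ≤ n → G.Adj (f u) (f v) → G.Adj u v := by
    intro u v hu hv huv
    have hv' : f v ∈ G.neighborSet (f u) := huv
    rw [← himage u hu] at hv'
    obtain ⟨w, hw, hwv⟩ := hv'
    have h1 := dist_le_succ_of_adj hT.isTree.connected x hw
    rwa [← hf.inj w v (by omega) hv hwv]
  let g : {z : V // G.dist x z ≤ n} → {z : V // G.dist y z ≤ n} :=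
    fun z => ⟨f z.1, by rw [hf.dist z.1 z.2]; exact z.2⟩
  have hg : Function.Bijective g := by
    refine ⟨fun u v huv => Subtype.ext (hf.inj _ _ u.2 v.2 (congrArg Subtype.val huv)), ?_⟩
    rintro ⟨z', hz'⟩
    obtain ⟨z, hz, rfl⟩ := hsurj _ hz' z' rfl
    exact ⟨⟨z, hz.trans hz'⟩, rfl⟩
  refine ⟨Equiv.ofBijective g hg, fun u v => ⟨hf.adj _ _ u.2 v.2, fun huv => ?_⟩,
    fun u => (hf.refine u.1 u.2).color.symm, hfx⟩
  change G.Adj (f u.1) (f v.1) at huv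
  have hu := hf.dist u.1 u.2
  have hv := hf.dist v.1 v.2
  have hu' := u.2
  have hv' := v.2
  rcases hT.isTree.dist_eq_dist_add_one_of_adj y huv with h | h
  · exact (hadj' v.1 u.1 (by omega) u.2 huv.symm).symm
  · exact hadj' u.1 v.1 (by omega) v.2 huv

lemma ballEquiv_iff_refine {d : ℕ} (hd : 0 < d) (hT : IsRegularTree G d) {n : ℕ} {x y : V} :
    BallEquiv G φ n x y ↔ Refine G φ n x y :=
  ⟨BallEquiv.refine hd hT, Refine.ballEquiv hd hT⟩

lemma ballClass_eq_iff {d : ℕ} (hd : 0 < d) (hT : IsRegularTree G d) {n : ℕ} {x y : V} :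
    ballClass G φ n x = ballClass G φ n y ↔ BallEquiv G φ n x y := by
  constructor
  · intro h
    have : y ∈ ballClass G φ n y := (Refine.refl n y).ballEquiv hd hT
    rwa [← h] at this
  · intro h
    rw [ballEquiv_iff_refine hd hT] at h
    ext z
    simp only [ballClass, Set.mem_ofPred_eq, ballEquiv_iff_refine hd hT]
    exact ⟨h.symm.trans, h.trans⟩

lemma nbrCount_eq_of_ballEquiv {d : ℕ} (hd : 0 < d) (hT : IsRegularTree G d) {n : ℕ} {x y : V}
    (h : BallEquiv G φ (n + 1) x y) (w : V) :
    nbrCount G x (ballClass G φ n w) = nbrCount G y (ballClass G φ n w) := by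
  rw [ballEquiv_iff_refine hd hT] at h
  obtain ⟨-, σ, hσ⟩ := h
  refine Set.ncard_congr (fun z hz => (σ ⟨z, hz.1⟩).1) (fun z hz => ⟨(σ ⟨z, hz.1⟩).2, ?_⟩)
    (fun u v hu hv huv => congrArg Subtype.val (σ.injective (Subtype.ext huv)))
    (fun z hz => ⟨(σ.symm ⟨z, hz.1⟩).1, ⟨(σ.symm ⟨z, hz.1⟩).2, ?_⟩, by simp⟩)
  · have hz2 := hz.2
    simp only [ballClass, Set.mem_ofPred_eq, ballEquiv_iff_refine hd hT] at hz2 ⊢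
    exact hz2.trans (hσ ⟨z, hz.1⟩)
  · have hz2 := hz.2
    have := hσ (σ.symm ⟨z, hz.1⟩)
    rw [Equiv.apply_symm_apply] at this
    simp only [ballClass, Set.mem_ofPred_eq, ballEquiv_iff_refine hd hT] at hz2 ⊢
    exact hz2.trans this.symm

/-- The class of an `(n+1)`-ball is determined by the color of its center and the numbers of
adjacent `n`-balls of each class. -/
lemma ballEquiv_succ_of_nbrCount_eq {d : ℕ} (hd : 0 < d) (hT : IsRegularTree G d) {n : ℕ}
    {x y : V} (hxy : BallEquiv G φ n x y)
    (h : ∀ w, nbrCount G x (ballClass G φ n w) = nbrCount G y (ballClass G φ n w)) :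
    BallEquiv G φ (n + 1) x y := by
  have hfib : ∀ (u w : V), Nat.card {z : G.neighborSet u //
      ballClass G φ n z.1 = ballClass G φ n w} = nbrCount G u (ballClass G φ n w) := by
    intro u w
    rw [nbrCount, ← Nat.card_coe_set_eq]
    refine Nat.card_congr ⟨fun z => ⟨z.1.1, z.1.2, ?_⟩, fun z => ⟨⟨z.1, z.2.1⟩, ?_⟩,
      fun _ => rfl, fun _ => rfl⟩
    · exact (ballClass_eq_iff hd hT).1 z.2.symm
    · exact ((ballClass_eq_iff hd hT).2 z.2.2).symm
  have key : ∀ C : Set V, Nonempty ({z : G.neighborSet x // ballClass G φ n z.1 = C} ≃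
      {z : G.neighborSet y // ballClass G φ n z.1 = C}) := by
    intro C
    have := (finite_neighborSet hd hT x).to_subtype
    have := (finite_neighborSet hd hT y).to_subtype
    by_cases hC : ∃ w, C = ballClass G φ n w
    · obtain ⟨w, rfl⟩ := hC
      exact Finite.card_eq.1 (by rw [hfib, hfib, h])
    · have h1 : IsEmpty {z : G.neighborSet x // ballClass G φ n z.1 = C} :=
        ⟨fun z => hC ⟨_, z.2.symm⟩⟩
      have h2 : IsEmpty {z : G.neighborSet y // ballClass G φ n z.1 = C} :=
        ⟨fun z => hC ⟨_, z.2.symm⟩⟩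
      exact ⟨Equiv.equivOfIsEmpty _ _⟩
  let e := fun C => (key C).some
  refine Refine.ballEquiv hd hT ⟨((ballEquiv_iff_refine hd hT).1 hxy).color,
    Equiv.ofFiberEquiv (f := fun z : G.neighborSet x => ballClass G φ n z.1)
      (g := fun z : G.neighborSet y => ballClass G φ n z.1) e, fun z => ?_⟩
  rw [← ballEquiv_iff_refine hd hT, ← ballClass_eq_iff hd hT]
  exact (Equiv.ofFiberEquiv_map e z).symm

/-- If a surjection onto a finite set drops the cardinality by one and identifies `s` and `t`,
these are the only elements it identifies. -/
lemma eq_or_of_ncard_eq_succ {β γ : Type*} {f : β → γ} {X : Set β} {Y : Set γ} {m : ℕ}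
    (hX : X.ncard = m + 1) (hY : Y.ncard = m) (himage : f '' X = Y) {s t : β} (hs : s ∈ X)
    (ht : t ∈ X) (hst : s ≠ t) (hf : f s = f t) {u v : β} (hu : u ∈ X) (hv : v ∈ X)
    (huv : f u = f v) (hus : u ≠ s) (hvs : v ≠ s) : u = v := by
  have hfin : X.Finite := Set.finite_of_ncard_pos (by omega)
  have hcard : (X \ {s}).ncard = m := by
    rw [Set.ncard_sdiff_singleton_of_mem hs, hX]; rfl
  have him : f '' (X \ {s}) = Y := by
    rw [← himage]
    refine (Set.image_mono Set.sdiff_subset).antisymm ?_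
    rintro _ ⟨w, hw, rfl⟩
    by_cases h : w = s
    · exact ⟨t, ⟨ht, hst.symm⟩, by rw [h, hf]⟩
    · exact ⟨w, ⟨hw, h⟩, rfl⟩
  have hinj : Set.InjOn f (X \ {s}) :=
    Set.injOn_of_ncard_image_eq (by rw [him, hcard, hY]) (hfin.subset Set.sdiff_subset)
  exact hinj ⟨hu, hus⟩ ⟨hv, hvs⟩ huv

/-- The only two `n`-equivalent vertices that can be separated at level `n + 1` are the
representatives `p`, `q` of the two extensions of the special ball. -/
structure IsSplitPair (G : SimpleGraph V) (φ : V → α) (n : ℕ) (p q : V) : Prop where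
  equiv : BallEquiv G φ n p q
  not_equiv : ¬ BallEquiv G φ (n + 1) p q
  cases : ∀ u v, BallEquiv G φ n u v → BallEquiv G φ (n + 1) u v ∨
    (BallEquiv G φ (n + 1) u p ∧ BallEquiv G φ (n + 1) v q) ∨
    (BallEquiv G φ (n + 1) u q ∧ BallEquiv G φ (n + 1) v p)

lemma BallEquiv.symm {d : ℕ} (hd : 0 < d) (hT : IsRegularTree G d) {n : ℕ} {x y : V}
    (h : BallEquiv G φ n x y) : BallEquiv G φ n y x :=
  (h.refine hd hT).symm.ballEquiv hd hT

lemma BallEquiv.trans {d : ℕ} (hd : 0 < d) (hT : IsRegularTree G d) {n : ℕ} {x y z : V}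
    (h : BallEquiv G φ n x y) (h' : BallEquiv G φ n y z) : BallEquiv G φ n x z :=
  ((h.refine hd hT).trans (h'.refine hd hT)).ballEquiv hd hT

lemma BallEquiv.of_succ {d : ℕ} (hd : 0 < d) (hT : IsRegularTree G d) {n : ℕ} {x y : V}
    (h : BallEquiv G φ (n + 1) x y) : BallEquiv G φ n x y :=
  (h.refine hd hT).of_succ.ballEquiv hd hT

lemma IsSplitPair.symm {d : ℕ} (hd : 0 < d) (hT : IsRegularTree G d) {n : ℕ} {p q : V}
    (h : IsSplitPair G φ n p q) : IsSplitPair G φ n q p :=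
  ⟨h.equiv.symm hd hT, fun h' => h.not_equiv (h'.symm hd hT),
    fun u v huv => (h.cases u v huv).imp_right Or.symm⟩

lemma IsSturmian.exists_isSplitPair {d : ℕ} (hd : 0 < d) (hT : IsRegularTree G d)
    (hSt : IsSturmian G φ) {n : ℕ} {S : Set V} (hS : IsSpecialClass G φ n S) :
    ∃ p q, S = ballClass G φ n p ∧ IsSplitPair G φ n p q := by
  obtain ⟨p, hSp, q, hpq, hnpq⟩ := hS
  refine ⟨p, q, hSp, hpq, hnpq, fun u v huv => ?_⟩
  have hrep : ∀ x : V, ballClass G φ (n + 1) x ∈ ballClasses G φ (n + 1) := fun x => ⟨x, rfl⟩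
  let f : Set V → Set V := fun C => {z | ∃ c ∈ C, BallEquiv G φ n c z}
  have hf : ∀ x, f (ballClass G φ (n + 1) x) = ballClass G φ n x := by
    intro x
    ext z
    constructor
    · rintro ⟨c, hc, hcz⟩
      exact (BallEquiv.of_succ hd hT hc).trans hd hT hcz
    · intro hz
      exact ⟨x, (Refine.refl _ x).ballEquiv hd hT, hz⟩
  have himage : f '' ballClasses G φ (n + 1) = ballClasses G φ n := by
    ext C
    constructor
    · rintro ⟨_, ⟨x, rfl⟩, rfl⟩
      exact ⟨x, hf x⟩
    · rintro ⟨x, rfl⟩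
      exact ⟨_, hrep x, hf x⟩
  have key : ∀ {u v}, BallEquiv G φ n u v → ¬ BallEquiv G φ (n + 1) u p →
      ¬ BallEquiv G φ (n + 1) v p → BallEquiv G φ (n + 1) u v := by
    intro u v huv hu hv
    rw [← ballClass_eq_iff hd hT] at huv hu hv hpq hnpq ⊢
    exact eq_or_of_ncard_eq_succ (hSt (n + 1)) (hSt n) himage (hrep p) (hrep q) hnpq
      (by rw [hf, hf, hpq]) (hrep u) (hrep v) (by rw [hf, hf, huv]) hu hv
  have hnqp : ¬ BallEquiv G φ (n + 1) q p := fun h => hnpq (h.symm hd hT)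
  by_cases hu : BallEquiv G φ (n + 1) u p
  · by_cases hv : BallEquiv G φ (n + 1) v p
    · exact Or.inl (hu.trans hd hT (hv.symm hd hT))
    · exact Or.inr (Or.inl ⟨hu, key (((huv.symm hd hT).trans hd hT
        (hu.of_succ hd hT)).trans hd hT hpq) hv hnqp⟩)
  · by_cases hv : BallEquiv G φ (n + 1) v p
    · exact Or.inr (Or.inr ⟨key ((huv.trans hd hT (hv.of_succ hd hT)).trans hd hT hpq)
        hu hnqp, hv⟩)
    · exact Or.inl (key huv hu hv)

/-- Vertices with equivalent `n`-balls can only differ in the numbers of neighbors in the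
`n`-classes of `p` and `q`, and the sum of these two numbers is the same for both. -/
def IsBalanced (G : SimpleGraph V) (φ : V → α) (n : ℕ) (p q : V) : Prop :=
  ∀ u v, BallEquiv G φ n u v →
    nbrCount G u (ballClass G φ n p) + nbrCount G u (ballClass G φ n q) =
      nbrCount G v (ballClass G φ n p) + nbrCount G v (ballClass G φ n q) ∧
    ∀ w, ¬ BallEquiv G φ n w p → ¬ BallEquiv G φ n w q →
      nbrCount G u (ballClass G φ n w) = nbrCount G v (ballClass G φ n w)

lemma nbrCount_union {d : ℕ} (hd : 0 < d) (hT : IsRegularTree G d) {n : ℕ} {p q : V}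
    (hpq : ¬ BallEquiv G φ n p q) (u : V) :
    nbrCount G u (ballClass G φ n p ∪ ballClass G φ n q) =
      nbrCount G u (ballClass G φ n p) + nbrCount G u (ballClass G φ n q) := by
  have hfin := finite_neighborSet hd hT u
  rw [nbrCount, Set.inter_union_distrib_left, Set.ncard_union_eq ?_
    (hfin.inter_of_left _) (hfin.inter_of_left _)]
  · rfl
  · rw [Set.disjoint_left]
    rintro z ⟨-, hp⟩ ⟨-, hq⟩
    exact hpq (BallEquiv.trans hd hT hp (BallEquiv.symm hd hT hq))

lemma IsSplitPair.isBalanced {d : ℕ} (hd : 0 < d) (hT : IsRegularTree G d) {n : ℕ} {p q : V}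
    (h : IsSplitPair G φ n p q) : IsBalanced G φ (n + 1) p q := by
  intro u v huv
  refine ⟨?_, fun w hp hq => ?_⟩
  · rw [← nbrCount_union hd hT h.not_equiv, ← nbrCount_union hd hT h.not_equiv]
    have : ballClass G φ (n + 1) p ∪ ballClass G φ (n + 1) q = ballClass G φ n p := by
      ext z
      constructor
      · rintro (hz | hz)
        · exact BallEquiv.of_succ hd hT hz
        · exact h.equiv.trans hd hT (BallEquiv.of_succ hd hT hz)
      · intro hz
        rcases h.cases p z hz with h' | ⟨-, h'⟩ | ⟨-, h'⟩
        · exact Or.inl h'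
        · exact Or.inr (h'.symm hd hT)
        · exact Or.inl (h'.symm hd hT)
    rw [this]
    exact nbrCount_eq_of_ballEquiv hd hT huv p
  · have : ballClass G φ (n + 1) w = ballClass G φ n w := by
      ext z
      refine ⟨fun hz => BallEquiv.of_succ hd hT hz, fun hz => ?_⟩
      rcases h.cases w z hz with h' | ⟨h', -⟩ | ⟨h', -⟩
      · exact h'
      · exact absurd h' hp
      · exact absurd h' hq
    rw [this]
    exact nbrCount_eq_of_ballEquiv hd hT huv w

/-- The extensions of the special ball are told apart by their neighbors in the class of `a`. -/
lemma IsBalanced.nbrCount_ne {d : ℕ} (hd : 0 < d) (hT : IsRegularTree G d) {n : ℕ} {a b p q : V}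
    (hab : IsBalanced G φ n a b) (h : IsSplitPair G φ n p q) :
    nbrCount G p (ballClass G φ n a) ≠ nbrCount G q (ballClass G φ n a) := by
  intro heq
  refine h.not_equiv (ballEquiv_succ_of_nbrCount_eq hd hT h.equiv fun w => ?_)
  obtain ⟨hsum, hne⟩ := hab p q h.equiv
  by_cases ha : BallEquiv G φ n w a
  · rw [(ballClass_eq_iff hd hT).2 ha, heq]
  · by_cases hb : BallEquiv G φ n w b
    · rw [(ballClass_eq_iff hd hT).2 hb]; omega
    · exact hne w ha hb

lemma IsSturmian.exists_ordered_isSplitPair {d : ℕ} (hd : 0 < d) (hT : IsRegularTree G d)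
    (hSt : IsSturmian G φ) {n : ℕ} {S : Set V} (hS : IsSpecialClass G φ n S) {a b : V}
    (hab : IsBalanced G φ n a b) :
    ∃ p q, S = ballClass G φ n p ∧ IsSplitPair G φ n p q ∧
      nbrCount G q (ballClass G φ n a) < nbrCount G p (ballClass G φ n a) := by
  obtain ⟨p, q, hSp, h⟩ := hSt.exists_isSplitPair hd hT hS
  rcases lt_or_gt_of_ne (hab.nbrCount_ne hd hT h) with hlt | hlt
  · exact ⟨q, p, hSp.trans ((ballClass_eq_iff hd hT).2 h.equiv), h.symm hd hT, hlt⟩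
  · exact ⟨p, q, hSp, h, hlt⟩

lemma IsSturmian.isBalanced_zero {d : ℕ} (hd : 0 < d) (hT : IsRegularTree G d)
    (hSt : IsSturmian G φ) {x y : V} (hxy : φ x ≠ φ y) : IsBalanced G φ 0 x y := by
  have hiff : ∀ u v : V, BallEquiv G φ 0 u v ↔ φ u = φ v := fun u v =>
    ballEquiv_iff_refine hd hT
  have hne : ballClass G φ 0 x ≠ ballClass G φ 0 y := by
    rw [Ne, ballClass_eq_iff hd hT, hiff]; exact hxy
  have hall : ∀ w, BallEquiv G φ 0 w x ∨ BallEquiv G φ 0 w y := by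
    intro w
    have h2 : (ballClasses G φ 0).ncard = 2 := hSt 0
    have hsub : ({ballClass G φ 0 x, ballClass G φ 0 y} : Set (Set V)) ⊆ ballClasses G φ 0 := by
      rintro _ (rfl | rfl)
      exacts [⟨x, rfl⟩, ⟨y, rfl⟩]
    have heq := Set.eq_of_subset_of_ncard_le hsub (by rw [h2, Set.ncard_pair hne])
      (Set.finite_of_ncard_pos (by omega))
    have hw : ballClass G φ 0 w ∈ ballClasses G φ 0 := ⟨w, rfl⟩
    rw [← heq] at hw
    exact hw.imp (ballClass_eq_iff hd hT).1 (ballClass_eq_iff hd hT).1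
  have huniv : ballClass G φ 0 x ∪ ballClass G φ 0 y = Set.univ := by
    rw [Set.eq_univ_iff_forall]
    exact fun w => (hall w).imp (BallEquiv.symm hd hT) (BallEquiv.symm hd hT)
  intro u v _
  refine ⟨?_, fun w hx hy => ((hall w).elim hx hy).elim⟩
  have hn : ¬ BallEquiv G φ 0 x y := by rw [hiff]; exact hxy
  rw [← nbrCount_union hd hT hn, ← nbrCount_union hd hT hn, huniv, nbrCount, nbrCount,
    Set.inter_univ, Set.inter_univ, hT.regular, hT.regular]

/-- Representatives `(a_n, b_n)` of the successive extensions, ordered at each step by the number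
of neighbors in the class of `a_n`. -/
lemma IsSturmian.exists_ordered_seq {d : ℕ} (hd : 0 < d) (hT : IsRegularTree G d)
    (hSt : IsSturmian G φ) {S : ℕ → Set V} (hS : ∀ n, IsSpecialClass G φ n (S n)) {x y : V}
    (hxy : φ x ≠ φ y) :
    ∃ a b : ℕ → V, a 0 = x ∧ b 0 = y ∧ ∀ n, IsBalanced G φ n (a n) (b n) ∧
      S n = ballClass G φ n (a (n + 1)) ∧ IsSplitPair G φ n (a (n + 1)) (b (n + 1)) ∧
      nbrCount G (b (n + 1)) (ballClass G φ n (a n)) <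
        nbrCount G (a (n + 1)) (ballClass G φ n (a n)) := by
  choose p q hp hq hlt using fun n (c : {c : V × V // IsBalanced G φ n c.1 c.2}) =>
    hSt.exists_ordered_isSplitPair hd hT (hS n) c.2
  let s : ∀ n, {c : V × V // IsBalanced G φ n c.1 c.2} := fun n =>
    Nat.rec ⟨(x, y), hSt.isBalanced_zero hd hT hxy⟩
      (fun n c => ⟨(p n c, q n c), (hq n c).isBalanced hd hT⟩) n
  exact ⟨fun n => (s n).1.1, fun n => (s n).1.2, rfl, rfl,
    fun n => ⟨(s n).2, hp n (s n), hq n (s n), hlt n (s n)⟩⟩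

end

/-- Lemma 2.2 (1): existence, well-definedness of the adjacency counts,
and uniqueness of the normalized labeling `A_n, B_n` of the extensions of the special
balls of a Sturmian coloring, given `S_0 = [a]` and `B_0 = [b]`. -/
theorem labeling_exists_unique {V α : Type} (G : SimpleGraph V) (d : ℕ) (hd : 3 ≤ d)
    (hT : IsRegularTree G d) (φ : V → α) (hSt : IsSturmian G φ)
    (a b : α) (hab : a ≠ b)
    (S : ℕ → Set V) (hS : ∀ n, IsSpecialClass G φ n (S n))
    (x0 : V) (hx0 : φ x0 = a) (hS0 : S 0 = ballClass G φ 0 x0)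
    (y0 : V) (hy0 : φ y0 = b) :
    ∃ A B : ℕ → Set V,
      (A 0 = S 0 ∧ B 0 = ballClass G φ 0 y0) ∧
      (∀ n, ∃ x, IsSpecialVert G φ n x ∧ S n = ballClass G φ n x ∧
        A (n + 1) = ballClass G φ (n + 1) x) ∧
      (∀ n, ∃ x, IsSpecialVert G φ n x ∧ S n = ballClass G φ n x ∧
        B (n + 1) = ballClass G φ (n + 1) x) ∧
      (∀ n, A (n + 1) ≠ B (n + 1)) ∧
      -- `A_{n+1}` is always adjacent to `A_n`, and `B_{n+1}` to `B_n`
      (∀ n, AlwaysAdjTo G (A (n + 1)) (A n) ∧ AlwaysAdjTo G (B (n + 1)) (B n)) ∧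
      -- the number of balls of class `A_n` (resp. `B_n`) adjacent to a ball of class
      -- `A_{n+1}` or `B_{n+1}` depends only on the classes involved
      (∀ n, ∀ Xc ∈ ({A (n + 1), B (n + 1)} : Set (Set V)),
        ∀ Yc ∈ ({A n, B n} : Set (Set V)),
        ∀ x ∈ Xc, ∀ x' ∈ Xc, nbrCount G x Yc = nbrCount G x' Yc) ∧
      -- `A_{n+1}` contains more adjacent balls of class `A_n` than `B_{n+1}` does
      (∀ n, ∀ x ∈ A (n + 1), ∀ y ∈ B (n + 1),
        nbrCount G y (A n) < nbrCount G x (A n)) ∧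
      -- uniqueness of the labeling subject to these requirements
      (∀ A' B' : ℕ → Set V,
        (A' 0 = S 0 ∧ B' 0 = ballClass G φ 0 y0) →
        (∀ n, ∃ x, IsSpecialVert G φ n x ∧ S n = ballClass G φ n x ∧
          A' (n + 1) = ballClass G φ (n + 1) x) →
        (∀ n, ∃ x, IsSpecialVert G φ n x ∧ S n = ballClass G φ n x ∧
          B' (n + 1) = ballClass G φ (n + 1) x) →
        (∀ n, A' (n + 1) ≠ B' (n + 1)) →
        (∀ n, AlwaysAdjTo G (A' (n + 1)) (A' n) ∧ AlwaysAdjTo G (B' (n + 1)) (B' n)) →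
        (∀ n, ∀ x ∈ A' (n + 1), ∀ y ∈ B' (n + 1),
          nbrCount G y (A' n) < nbrCount G x (A' n)) →
        ∀ n, A' n = A n ∧ B' n = B n) := by

  have hd0 : 0 < d := by omega
  have hxy : φ x0 ≠ φ y0 := by rwa [hx0, hy0]
  obtain ⟨p, q, hp0, hq0, hpq⟩ := hSt.exists_ordered_seq hd0 hT hS hxy
  choose hbal hSp hsplit hlt using hpq
  have hself : ∀ n x, x ∈ ballClass G φ n x := fun n x =>
    (Refine.refl n x).ballEquiv hd0 hT
  have hSq : ∀ n, S n = ballClass G φ n (q (n + 1)) := fun n =>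
    (hSp n).trans ((ballClass_eq_iff hd0 hT).2 (hsplit n).equiv)
  have hcount : ∀ n, ∀ x ∈ ballClass G φ (n + 1) (p (n + 1)),
      ∀ y ∈ ballClass G φ (n + 1) (q (n + 1)),
      nbrCount G y (ballClass G φ n (p n)) < nbrCount G x (ballClass G φ n (p n)) := by
    intro n x hx y hy
    rw [← nbrCount_eq_of_ballEquiv hd0 hT hx, ← nbrCount_eq_of_ballEquiv hd0 hT hy]
    exact hlt n
  have hadj : ∀ x C, 0 < nbrCount G x C → ∃ y, G.Adj x y ∧ y ∈ C := fun x C h =>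
    Set.nonempty_of_ncard_ne_zero h.ne'
  have hext : ∀ n x, S n = ballClass G φ n x →
      ballClass G φ (n + 1) x = ballClass G φ (n + 1) (p (n + 1)) ∨
      ballClass G φ (n + 1) x = ballClass G φ (n + 1) (q (n + 1)) := by
    intro n x hx
    rw [ballClass_eq_iff hd0 hT, ballClass_eq_iff hd0 hT]
    have hx' : BallEquiv G φ n x (p (n + 1)) := (ballClass_eq_iff hd0 hT).1 (hx.symm.trans (hSp n))
    rcases (hsplit n).cases _ _ hx' with h | h | h
    exacts [Or.inl h, Or.inl h.1, Or.inr h.1]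
  refine ⟨fun n => ballClass G φ n (p n), fun n => ballClass G φ n (q n),
    ⟨by simp only [hp0, hS0], by simp only [hq0]⟩,
    fun n => ⟨p (n + 1), ⟨q (n + 1), (hsplit n).equiv, (hsplit n).not_equiv⟩, hSp n, rfl⟩,
    fun n => ⟨q (n + 1), ⟨p (n + 1), (hsplit n).equiv.symm hd0 hT,
      ((hsplit n).symm hd0 hT).not_equiv⟩, hSq n, rfl⟩,
    fun n h => (hsplit n).not_equiv ((ballClass_eq_iff hd0 hT).1 h),
    fun n => ⟨fun x hx => ?_, fun y hy => ?_⟩, ?_, hcount, ?_⟩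
  · exact hadj _ _ ((Nat.zero_le _).trans_lt (hcount n x hx _ (hself _ _)))
  · refine hadj _ _ ?_
    have h1 := hcount n _ (hself _ _) y hy
    have h2 : BallEquiv G φ n (p (n + 1)) y :=
      (hsplit n).equiv.trans hd0 hT (BallEquiv.of_succ hd0 hT hy)
    have h3 := (hbal n _ _ h2).1
    simp only
    omega
  · rintro n Xc hXc Yc hYc x hx x' hx'
    have hX : ∃ u, Xc = ballClass G φ (n + 1) u := by
      rcases hXc with rfl | rfl
      exacts [⟨_, rfl⟩, ⟨_, rfl⟩]
    have hY : ∃ u, Yc = ballClass G φ n u := by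
      rcases hYc with rfl | rfl
      exacts [⟨_, rfl⟩, ⟨_, rfl⟩]
    obtain ⟨u, rfl⟩ := hX
    obtain ⟨w, rfl⟩ := hY
    rw [← nbrCount_eq_of_ballEquiv hd0 hT hx, ← nbrCount_eq_of_ballEquiv hd0 hT hx']
  · rintro A' B' ⟨hA0, hB0⟩ hA hB hne - hlt' n
    induction n with
    | zero => exact ⟨by simp only [hA0, hp0, hS0], by simp only [hB0, hq0]⟩
    | succ n ih =>
      obtain ⟨x, -, hx, hxA⟩ := hA n
      obtain ⟨y, -, hy, hyB⟩ := hB n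
      have hn := hne n
      have hc := hlt' n
      rw [ih.1] at hc
      rcases hext n x hx with h1 | h1 <;> rcases hext n y hy with h2 | h2 <;>
        rw [← hxA] at h1 <;> rw [← hyB] at h2 <;> rw [h1, h2] at hn hc ⊢
      · exact absurd rfl hn
      · exact ⟨rfl, rfl⟩
      · exact absurd (hc _ (hself _ _) _ (hself _ _)) (hlt n).not_gt
      · exact absurd rfl hn

end Sturm
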